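/- arXiv:1010.2287 — 5 statements merged into one kernel-verified Lean document; each statement's English description precedes it below -/
import Mathlib

section
/- Let (E, e₁, e₂) be a key-sharing graph on a finite nonempty type V of vertices such that the graph is connected on V using all edges of E. Then for every function δ : V → ZMod 2 with Σ_{x ∈ V} δ x = 0, there exists a function d : E → ZMod 2 such that for every vertex x, Σ_{ε ∈ keys(x)} d ε = δ x. -/
/-- The set of edges incident on agent `j` (the keys held by `j`). -/
def dcKeys {Agt E : Type*} (e1 e2 : E → Agt) (j : Agt) : Set E :=
  {ε | e1 ε = j ∨ e2 ε = j}

/-- The exclusive-or (sum in `ZMod 2`) of the values of `d` over the edges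
incident on agent `j`. -/
def keySum {Agt E : Type*} [Fintype E] [DecidableEq Agt]
    (e1 e2 : E → Agt) (j : Agt) (d : E → ZMod 2) : ZMod 2 :=
  ∑ ε ∈ Finset.univ.filter (fun ε => e1 ε = j ∨ e2 ε = j), d ε

/-- One step between agents `x` and `y` within the set `S` of agents, along
an edge from `F` whose two endpoints are `x` and `y`. -/
def EdgeStep {Agt E : Type*} (e1 e2 : E → Agt) (F : Set E) (S : Set Agt)
    (x y : Agt) : Prop :=
  x ∈ S ∧ y ∈ S ∧ ∃ ε ∈ F, (e1 ε = x ∧ e2 ε = y) ∨ (e1 ε = y ∧ e2 ε = x)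

/-- The graph is connected on the set `S` of agents using the set `F` of edges:
any two agents of `S` are joined by a finite path of edges from `F` all of
whose agents lie in `S`. -/
def ConnectedOn {Agt E : Type*} (e1 e2 : E → Agt) (S : Set Agt) (F : Set E) : Prop :=
  ∀ x ∈ S, ∀ y ∈ S, Relation.ReflTransGen (EdgeStep e1 e2 F S) x y

/-- Every vertex reachable from `r` has a key assignment whose vertex sums are the
indicator of `r` plus the indicator of that vertex. -/
theorem exists_path_keys {V E : Type*} [DecidableEq V] [Fintype E]
    (e1 e2 : E → V) (hloop : ∀ ε, e1 ε ≠ e2 ε) (r x : V)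
    (h : Relation.ReflTransGen (EdgeStep e1 e2 Set.univ Set.univ) r x) :
    ∃ p : E → ZMod 2, ∀ y, keySum e1 e2 y p =
      (if y = r then 1 else 0) + (if y = x then 1 else 0) := by
  classical
  induction h with
  | refl =>
    refine ⟨fun _ => 0, fun y => ?_⟩
    simp only [keySum, Finset.sum_const_zero]
    exact (CharTwo.add_self_eq_zero _).symm
  | @tail b c _ hs ih =>
    obtain ⟨p, hp⟩ := ih
    obtain ⟨-, -, ε, -, hε⟩ := hs
    refine ⟨fun e => p e + if e = ε then 1 else 0, fun y => ?_⟩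
    have h1 : keySum e1 e2 y (fun e => p e + if e = ε then 1 else 0)
        = keySum e1 e2 y p + if (e1 ε = y ∨ e2 ε = y) then 1 else 0 := by
      simp [keySum, Finset.sum_add_distrib]
    have h2 : (if (e1 ε = y ∨ e2 ε = y) then (1 : ZMod 2) else 0)
        = (if y = b then 1 else 0) + (if y = c then 1 else 0) := by
      have := hloop ε
      rcases hε with ⟨rfl, rfl⟩ | ⟨rfl, rfl⟩ <;> clear h1 hp <;> grind
    rw [h1, hp, h2]
    have := CharTwo.add_self_eq_zero (if y = b then (1 : ZMod 2) else 0)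
    linear_combination this

/-- on a connected key-sharing graph, every `ZMod 2`-valued
assignment `δ` to the vertices summing to `0` is realized as the incident-key
xor of some key assignment `d` on the edges. -/
theorem exists_keys_realizing {V E : Type*} [Fintype V] [Nonempty V] [DecidableEq V]
    [Fintype E]
    (e1 e2 : E → V) (hloop : ∀ ε, e1 ε ≠ e2 ε)
    (hconn : ConnectedOn e1 e2 Set.univ Set.univ)
    (δ : V → ZMod 2) (hδ : ∑ x, δ x = 0) :
    ∃ d : E → ZMod 2, ∀ x, keySum e1 e2 x d = δ x := by
  classical
  obtain ⟨r⟩ := ‹Nonempty V›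
  choose p hp using fun x => exists_path_keys e1 e2 hloop r x
    (hconn r (Set.mem_univ _) x (Set.mem_univ _))
  refine ⟨fun e => ∑ x, δ x * p x e, fun y => ?_⟩
  have h1 : keySum e1 e2 y (fun e => ∑ x, δ x * p x e)
      = ∑ x, δ x * keySum e1 e2 y (p x) := by
    simp only [keySum, Finset.mul_sum]
    exact Finset.sum_comm
  rw [h1]
  simp only [hp, mul_add, Finset.sum_add_distrib, ← Finset.sum_mul, hδ]
  simp
end

section
/- (Chaum's key lemma.) Let (E, e₁, e₂) be a key-sharing graph on a finite type Agt of agents and fix an agent i ∈ Agt. Assume the graph is connected on Agt ∖ {i} using the edges in E ∖ keys(i). Let κ : E → ZMod 2 and μ, μ' : Agt → ZMod 2 satisfy Σ_{j ∈ Agt} μ j = Σ_{j ∈ Agt} μ' j and μ i = μ' i. Then there exists λ : E → ZMod 2 such that λ ε = κ ε for all ε ∈ keys(i), and for every agent j ∈ Agt, μ j + Σ_{ε ∈ keys(j)} κ ε = μ' j + Σ_{ε ∈ keys(j)} λ ε (in ZMod 2). -/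
theorem keySum_eq {Agt E : Type*} [Fintype E] [DecidableEq Agt]
    (e1 e2 : E → Agt) (j : Agt) (d : E → ZMod 2) :
    keySum e1 e2 j d = ∑ ε, if e1 ε = j ∨ e2 ε = j then d ε else 0 := by
  unfold keySum
  rw [Finset.sum_filter]

theorem keySum_add' {Agt E : Type*} [Fintype E] [DecidableEq Agt]
    (e1 e2 : E → Agt) (j : Agt) (d d' : E → ZMod 2) :
    keySum e1 e2 j (fun ε => d ε + d' ε) = keySum e1 e2 j d + keySum e1 e2 j d' := by
  unfold keySum
  rw [Finset.sum_add_distrib]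

theorem path_lemma {Agt E : Type*} [DecidableEq Agt] [Fintype E]
    (e1 e2 : E → Agt) (hloop : ∀ ε, e1 ε ≠ e2 ε) (F : Set E) (S : Set Agt) (x y : Agt)
    (h : Relation.ReflTransGen (EdgeStep e1 e2 F S) x y) :
    ∃ d : E → ZMod 2, (∀ ε, ε ∉ F → d ε = 0) ∧
      ∀ j, keySum e1 e2 j d = (if j = x then 1 else 0) + (if j = y then 1 else 0) := by
  classical
  induction h with
  | refl =>
    refine ⟨fun _ => 0, fun _ _ => rfl, fun j => ?_⟩
    rw [CharTwo.add_self_eq_zero]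
    simp [keySum]
  | @tail b c _ hs ih =>
    obtain ⟨d, hd, hk⟩ := ih
    obtain ⟨_, _, ε, hε, he⟩ := hs
    refine ⟨fun η => d η + (if η = ε then 1 else 0), ?_, fun j => ?_⟩
    · intro η hη
      have : η ≠ ε := fun h => hη (h ▸ hε)
      simp [hd η hη, this]
    · have h1 : keySum e1 e2 j (fun η => if η = ε then (1 : ZMod 2) else 0)
          = (if j = b then 1 else 0) + (if j = c then 1 else 0) := by
        unfold keySum
        rw [Finset.sum_ite_eq']
        have hl := hloop ε
        simp only [Finset.mem_filter, Finset.mem_univ, true_and]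
        rcases he with ⟨rfl, rfl⟩ | ⟨rfl, rfl⟩ <;>
        · by_cases ha : j = e1 ε
          · subst ha
            simp [hl]
          · by_cases hb : j = e2 ε
            · subst hb
              simp [hl.symm]
            · simp [ha, hb, Ne.symm ha, Ne.symm hb]
      rw [keySum_add', hk, h1]
      have := CharTwo.add_self_eq_zero (if j = b then (1 : ZMod 2) else 0)
      linear_combination this

/-- Chaum's key lemma: if the key-sharing graph is connected on
`Agt ∖ {i}` using the edges not incident on `i`, and `μ, μ'` have the same
total xor and agree at `i`, then the keys `κ` can be replaced by keys `λ`
agreeing with `κ` on `keys(i)` while producing, for every agent, broadcasts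
under `μ'` equal to the broadcasts under `μ` with keys `κ`. -/
theorem chaum_key_lemma {Agt E : Type*} [Fintype Agt] [DecidableEq Agt] [Fintype E]
    (e1 e2 : E → Agt) (hloop : ∀ ε, e1 ε ≠ e2 ε) (i : Agt)
    (hconn : ConnectedOn e1 e2 {j | j ≠ i} {ε | ε ∉ dcKeys e1 e2 i})
    (κ : E → ZMod 2) (μ μ' : Agt → ZMod 2)
    (hsum : ∑ j, μ j = ∑ j, μ' j) (hi : μ i = μ' i) :
    ∃ lam : E → ZMod 2,
      (∀ ε ∈ dcKeys e1 e2 i, lam ε = κ ε) ∧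
      ∀ j, μ j + keySum e1 e2 j κ = μ' j + keySum e1 e2 j lam := by
  classical
  by_cases hr : ∃ r, r ≠ i
  · obtain ⟨r, hr⟩ := hr
    have hex : ∀ y, ∃ d : E → ZMod 2, y ≠ i → (∀ ε ∈ dcKeys e1 e2 i, d ε = 0) ∧
        ∀ j, keySum e1 e2 j d = (if j = r then 1 else 0) + (if j = y then 1 else 0) := by
      intro y
      by_cases hy : y = i
      · exact ⟨0, fun h => absurd hy h⟩
      · obtain ⟨d, h1, h2⟩ := path_lemma e1 e2 hloop _ _ r y (hconn r hr y hy)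
        exact ⟨d, fun _ => ⟨fun ε hε => h1 ε (fun h => h hε), h2⟩⟩
    choose D hD using hex
    have hz : μ i - μ' i = 0 := by rw [hi, sub_self]
    refine ⟨fun ε => κ ε + ∑ y, (μ y - μ' y) * D y ε, ?_, ?_⟩
    · intro ε hε
      have : ∑ y, (μ y - μ' y) * D y ε = 0 := by
        refine Finset.sum_eq_zero fun y _ => ?_
        by_cases hy : y = i
        · rw [hy, hz, zero_mul]
        · rw [(hD y hy).1 ε hε, mul_zero]
      simp only [this, add_zero]
    · intro j
      have h1 : keySum e1 e2 j (fun ε => ∑ y, (μ y - μ' y) * D y ε) = μ j - μ' j := by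
        have h2 : keySum e1 e2 j (fun ε => ∑ y, (μ y - μ' y) * D y ε)
            = ∑ y, (μ y - μ' y) * keySum e1 e2 j (D y) := by
          unfold keySum
          rw [Finset.sum_comm]
          simp only [Finset.mul_sum]
        have h3 : ∀ y, (μ y - μ' y) * keySum e1 e2 j (D y) =
            (μ y - μ' y) * (if j = r then 1 else 0) + (if j = y then (μ y - μ' y) else 0) := by
          intro y
          by_cases hy : y = i
          · subst hy
            simp [hz]
          · rw [(hD y hy).2 j, mul_add, mul_ite, mul_ite, mul_one, mul_zero]
        rw [h2, Finset.sum_congr rfl fun y _ => h3 y, Finset.sum_add_distrib, ← Finset.sum_mul,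
          Finset.sum_sub_distrib, hsum, sub_self, zero_mul, zero_add]
        simp
      rw [keySum_add', h1]
      ring
  · push Not at hr
    refine ⟨κ, fun _ _ => rfl, fun j => ?_⟩
    rw [hr j, hi]
end

section
/- Let (E, e₁, e₂) be a key-sharing graph on a finite type Agt of agents. Then for every κ : E → ZMod 2, Σ_{j ∈ Agt} Σ_{ε ∈ keys(j)} κ ε = 0 in ZMod 2 (each edge is counted exactly twice, once for each of its two distinct endpoints). Consequently, for every m : Agt → ZMod 2, Σ_{j ∈ Agt} (m j + Σ_{ε ∈ keys(j)} κ ε) = Σ_{j ∈ Agt} m j; that is, the exclusive-or of the values broadcast in the Dining Cryptographers protocol (each agent j broadcasting its message m j xor-ed with all its incident keys κ) equals the exclusive-or of all the messages. -/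
/-- the xor over all agents of the incident-key xors is `0`
(each edge is counted twice), and consequently the xor of all the DC
broadcasts equals the xor of all the messages. -/
theorem dc_broadcast_xor {Agt E : Type*} [Fintype Agt] [DecidableEq Agt] [Fintype E]
    (e1 e2 : E → Agt) (hloop : ∀ ε, e1 ε ≠ e2 ε) (κ : E → ZMod 2) :
    (∑ j, keySum e1 e2 j κ = 0) ∧
    ∀ m : Agt → ZMod 2, ∑ j, (m j + keySum e1 e2 j κ) = ∑ j, m j := by
  have h : ∑ j, keySum e1 e2 j κ = 0 := by
    simp only [keySum, Finset.sum_filter]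
    rw [Finset.sum_comm]
    refine Finset.sum_eq_zero fun ε _ => ?_
    have key : ∀ j, (if e1 ε = j ∨ e2 ε = j then κ ε else 0)
        = (if e1 ε = j then κ ε else 0) + (if e2 ε = j then κ ε else 0) := by
      intro j
      have := hloop ε
      by_cases h1 : e1 ε = j <;> by_cases h2 : e2 ε = j <;> simp_all
    simp only [key, Finset.sum_add_distrib, Finset.sum_ite_eq, Finset.mem_univ, if_true]
    exact CharTwo.add_self_eq_zero _
  exact ⟨h, fun m => by rw [Finset.sum_add_distrib, h, add_zero]⟩
end

section
/- (Fresh-variable extension preserves bisimulation.) Let M and N be epistemic Kripke structures over Var and Agt with worlds W^M and W^N, and let R be a bisimulation between M and N. Let V_A be a type of fresh variables, K a type of random seeds, S : Agt → Set V_A an assignment of newly observable variables to agents, and f^M : W^M → K → V_A → Bool, f^N : W^N → K → V_A → Bool functions giving the values of the fresh variables, such that whenever u R v then f^M u κ = f^N v κ for all κ ∈ K. Define the extended structure M' with worlds W^M × K, relations (u,κ) ∼'_i (v,λ) iff u ∼^M_i v and f^M u κ x = f^M v λ x for all x ∈ S i, and valuation over Var ⊕ V_A assigning to (u,κ) the value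 π^M u v at each v ∈ Var and f^M u κ x at each x ∈ V_A; define N' from N, f^N analogously. Then the relation R' defined by (u,κ) R' (v,λ) iff u R v and κ = λ is a bisimulation between M' and N' with respect to Var ⊕ V_A and Agt. -/
/-- An epistemic Kripke structure over variables `Var` and agents `Agt`,
with worlds `W`: for each agent an equivalence relation on worlds, and a
Boolean valuation of the variables at each world. -/
structure Kripke (Var Agt W : Type*) where
  rel : Agt → W → W → Prop
  equiv : ∀ i, Equivalence (rel i)
  val : W → Var → Bool

/-- Formulas of the epistemic language `L(Var, Agt)`:
`⊤ | v | ¬φ | φ ∧ φ | K_i φ`. -/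
inductive EFormula (Var Agt : Type*) : Type _ where
  | top : EFormula Var Agt
  | var : Var → EFormula Var Agt
  | neg : EFormula Var Agt → EFormula Var Agt
  | and : EFormula Var Agt → EFormula Var Agt → EFormula Var Agt
  | know : Agt → EFormula Var Agt → EFormula Var Agt

/-- Satisfaction `M, w ⊨ φ`. -/
def Kripke.Sat {Var Agt W : Type*} (M : Kripke Var Agt W) : W → EFormula Var Agt → Prop
  | _, .top => True
  | w, .var v => M.val w v = true
  | w, .neg φ => ¬ M.Sat w φ
  | w, .and φ ψ => M.Sat w φ ∧ M.Sat w ψ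
  | w, .know i φ => ∀ w', M.rel i w w' → M.Sat w' φ

/-- A bisimulation between two epistemic Kripke structures over the same
`Var` and `Agt`: the Atoms, Forth and Back conditions. -/
def Bisim {Var Agt W₁ W₂ : Type*} (M : Kripke Var Agt W₁) (N : Kripke Var Agt W₂)
    (R : W₁ → W₂ → Prop) : Prop :=
  (∀ w u, R w u → ∀ v, M.val w v = N.val u v) ∧
  (∀ i w₁ w₂ u₁, M.rel i w₁ w₂ → R w₁ u₁ → ∃ u₂, N.rel i u₁ u₂ ∧ R w₂ u₂) ∧
  (∀ i u₁ u₂ w₁, N.rel i u₁ u₂ → R w₁ u₁ → ∃ w₂, M.rel i w₁ w₂ ∧ R w₂ u₂)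


/-- The extension of a Kripke structure `M` by fresh variables `VA` valued by
`f` (depending on the old world and a random seed from `K`), where agent `i`
newly observes the variables in `S i`: worlds are pairs `(u, κ)`, agent `i`
cannot distinguish two worlds iff their `M`-components are `∼_i`-related and
the fresh variables observable to `i` have the same values; the valuation
extends that of `M` by the values of the fresh variables. -/
def ExtendK {Var Agt W VA K : Type*} (M : Kripke Var Agt W)
    (S : Agt → Set VA) (f : W → K → VA → Bool) :
    Kripke (Var ⊕ VA) Agt (W × K) where
  rel i p q := M.rel i p.1 q.1 ∧ ∀ x ∈ S i, f p.1 p.2 x = f q.1 q.2 x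
  equiv i :=
    ⟨fun _ => ⟨(M.equiv i).refl _, fun _ _ => rfl⟩,
     fun h => ⟨(M.equiv i).symm h.1, fun x hx => (h.2 x hx).symm⟩,
     fun h h' => ⟨(M.equiv i).trans h.1 h'.1,
       fun x hx => (h.2 x hx).trans (h'.2 x hx)⟩⟩
  val p x :=
    match x with
    | Sum.inl v => M.val p.1 v
    | Sum.inr y => f p.1 p.2 y

/-- fresh-variable extension preserves bisimulation: if `R` is a
bisimulation between `M` and `N` and the fresh-variable valuations agree across
`R`-related worlds, then `(u,κ) R' (v,λ) ↔ R u v ∧ κ = λ` is a bisimulation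
between the extended structures. -/
theorem extend_bisim {Var Agt W₁ W₂ VA K : Type*}
    (M : Kripke Var Agt W₁) (N : Kripke Var Agt W₂)
    (R : W₁ → W₂ → Prop) (hbisim : Bisim M N R)
    (S : Agt → Set VA)
    (fM : W₁ → K → VA → Bool) (fN : W₂ → K → VA → Bool)
    (hf : ∀ u v, R u v → ∀ κ : K, fM u κ = fN v κ) :
    Bisim (ExtendK M S fM) (ExtendK N S fN)
      (fun p q => R p.1 q.1 ∧ p.2 = q.2) := by
  obtain ⟨hA, hF, hB⟩ := hbisim
  refine ⟨?_, ?_, ?_⟩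
  · rintro ⟨w, k⟩ ⟨u, l⟩ ⟨h, hk⟩ v
    dsimp only at h hk
    subst hk
    cases v with
    | inl v => exact hA w u h v
    | inr y => exact congrFun (hf w u h k) y
  · rintro i ⟨w₁, k₁⟩ ⟨w₂, k₂⟩ ⟨u₁, l₁⟩ ⟨hr, hx⟩ ⟨h, hk⟩
    dsimp only at hr hx h hk
    subst hk
    obtain ⟨u₂, hu, hR⟩ := hF i w₁ w₂ u₁ hr h
    refine ⟨(u₂, k₂), ⟨hu, fun x hxS => ?_⟩, hR, rfl⟩
    have := hx x hxS
    rw [hf _ _ h, hf _ _ hR] at this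
    exact this
  · rintro i ⟨u₁, l₁⟩ ⟨u₂, l₂⟩ ⟨w₁, k₁⟩ ⟨hr, hx⟩ ⟨h, hk⟩
    dsimp only at hr hx h hk
    subst hk
    obtain ⟨w₂, hw, hR⟩ := hB i u₁ u₂ w₁ hr h
    refine ⟨(w₂, l₂), ⟨hw, fun x hxS => ?_⟩, hR, rfl⟩
    have := hx x hxS
    rw [← hf _ _ h, ← hf _ _ hR] at this
    exact this
end

section
/- (Iterated Dining Cryptographers abstraction.) Let M and M^a be epistemic Kripke structures over Var and a finite type Agt of agents, with worlds W and W^a, let R be a bisimulation between M and M^a, and let (E, e₁, e₂) be a key-sharing graph on Agt such that for every agent i the graph is connected on Agt ∖ {i} using the edges in E ∖ keys(i). Define inductively: W₀ = W with relations ∼^{c,0}_i = ∼^M_i; for t = 1,…,k, given message functions m_t : Agt → W_{t-1} → ZMod 2, set W_t = W_{t-1} × (E → ZMod 2) with relations (u,κ) ∼^{c,t}_i (v,λ) iff u ∼^{c,t-1}_i v, κ ε = λ ε for all ε ∈ keys(i), and for every agent j, m_t j u + Σ_{ε ∈ keys(j)} κ ε = m_t j v + Σ_{ε ∈ keys(j)}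 λ ε. On the abstract side, set ∼^{a,0}_i = ∼^{M^a}_i and, given message functions m^a_t : Agt → W^a → ZMod 2, set u' ∼^{a,t}_i v' iff u' ∼^{a,t-1}_i v' and Σ_j m^a_t j u' = Σ_j m^a_t j v'. Define ℜ₀ = R and (w,κ) ℜ_t u' iff w ℜ_{t-1} u'. Assume for each t = 1,…,k: (i) whenever w ℜ_{t-1} u' then m_t j w = m^a_t j u' for all j ∈ Agt; and (ii) for every agent i, whenever w ∼^{c,t-1}_i v then m_t i w = m_t i v. Then ℜ_k is a bisimulation between the stage-k structures with respect to Var ∪ {rr_1,…,rr_k} and Agt, where the valuation of the stage-k concrete structure assigns to a world with stage-(t-1) component w the value Σ_j m_t j w at rr_t (and the value π^M of the W-component at each v ∈ Var), and the abstract valuation assigns Σ_j m^a_t j u' at rr_t (and π^{M^a} u' at each v ∈ Var). -/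
/-- Stage-`t` concrete worlds: `W₀ = W`, `W_{t+1} = W_t × (E → ZMod 2)`
(a fresh key assignment is added at each round). -/
def IterW (W E : Type) : ℕ → Type
  | 0 => W
  | t + 1 => IterW W E t × (E → ZMod 2)

/-- The base (`W`-) component of a stage-`k` concrete world. -/
def IterW.base {W E : Type} : (k : ℕ) → IterW W E k → W
  | 0, w => w
  | t + 1, p => IterW.base t p.1

/-- Stage-`t` concrete indistinguishability: at stage `0` it is the relation
of `M`; each subsequent round adds agreement on the keys incident on `i` and
on all agents' broadcasts for the round-`(t+1)` messages `m t` (which may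
depend on the whole concrete history). -/
def IterRelC {W E Agt : Type} [Fintype E] [DecidableEq Agt]
    (e1 e2 : E → Agt) (rel0 : Agt → W → W → Prop)
    (m : (t : ℕ) → Agt → IterW W E t → ZMod 2) :
    (t : ℕ) → Agt → IterW W E t → IterW W E t → Prop
  | 0 => rel0
  | t + 1 => fun i p q =>
      IterRelC e1 e2 rel0 m t i p.1 q.1 ∧
      (∀ ε ∈ dcKeys e1 e2 i, p.2 ε = q.2 ε) ∧
      ∀ j, m t j p.1 + keySum e1 e2 j p.2 = m t j q.1 + keySum e1 e2 j q.2

/-- Stage-`t` abstract indistinguishability: at stage `0` it is the relation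
of `Mᵃ`; each subsequent round adds agreement on the xor of the round-`(t+1)`
messages `ma t`. -/
def IterRelA {Wa Agt : Type} [Fintype Agt] (rel0 : Agt → Wa → Wa → Prop)
    (ma : ℕ → Agt → Wa → ZMod 2) : ℕ → Agt → Wa → Wa → Prop
  | 0 => rel0
  | t + 1 => fun i u v =>
      IterRelA rel0 ma t i u v ∧ (∑ j, ma t j u) = (∑ j, ma t j v)

/-- The stage-`t` relation `ℜ_t`: `ℜ₀ = R` and `(w,κ) ℜ_{t+1} u' ↔ w ℜ_t u'`. -/
def IterR {W E Wa : Type} (R : W → Wa → Prop) :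
    (t : ℕ) → IterW W E t → Wa → Prop
  | 0 => R
  | t + 1 => fun p u' => IterR R t p.1 u'

/-- The round result `rr_t` (for `t : Fin k`) at a stage-`k` concrete world:
the xor of the round-`(t+1)` messages evaluated at the stage-`t` component. -/
def rrConc {W E Agt : Type} [Fintype Agt]
    (m : (t : ℕ) → Agt → IterW W E t → ZMod 2) :
    (k : ℕ) → IterW W E k → Fin k → ZMod 2
  | 0, _, t => t.elim0
  | k + 1, p, t =>
      if h : (t : ℕ) = k then ∑ j, m k j p.1
      else rrConc m k p.1 ⟨t, by have := t.isLt; omega⟩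

theorem IterRelC_equiv {W E Agt : Type} [Fintype E] [DecidableEq Agt]
    (e1 e2 : E → Agt) (rel0 : Agt → W → W → Prop)
    (h0 : ∀ i, Equivalence (rel0 i))
    (m : (t : ℕ) → Agt → IterW W E t → ZMod 2) :
    ∀ t i, Equivalence (IterRelC e1 e2 rel0 m t i) := by
  intro t
  induction t with
  | zero => exact h0
  | succ t ih =>
    intro i
    constructor
    · intro p
      exact ⟨(ih i).refl _, fun _ _ => rfl, fun _ => rfl⟩
    · rintro p q ⟨h1, h2, h3⟩
      exact ⟨(ih i).symm h1, fun ε hε => (h2 ε hε).symm, fun j => (h3 j).symm⟩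
    · rintro p q r ⟨h1, h2, h3⟩ ⟨h1', h2', h3'⟩
      exact ⟨(ih i).trans h1 h1', fun ε hε => (h2 ε hε).trans (h2' ε hε),
        fun j => (h3 j).trans (h3' j)⟩

theorem IterRelA_equiv {Wa Agt : Type} [Fintype Agt]
    (rel0 : Agt → Wa → Wa → Prop) (h0 : ∀ i, Equivalence (rel0 i))
    (ma : ℕ → Agt → Wa → ZMod 2) :
    ∀ t i, Equivalence (IterRelA rel0 ma t i) := by
  intro t
  induction t with
  | zero => exact h0
  | succ t ih =>
    intro i
    constructor
    · intro u
      exact ⟨(ih i).refl _, rfl⟩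
    · rintro u v ⟨h1, h2⟩
      exact ⟨(ih i).symm h1, h2.symm⟩
    · rintro u v w ⟨h1, h2⟩ ⟨h1', h2'⟩
      exact ⟨(ih i).trans h1 h1', h2.trans h2'⟩

/-- The stage-`k` concrete Kripke structure: worlds `IterW W E k`, relations
`IterRelC`, and valuation over `Var ⊕ Fin k` assigning the `M`-valuation of
the base component at each `v : Var` and the round result `rr_t` at each
`t : Fin k`. -/
def IterConcK {Var W E Agt : Type} [Fintype Agt] [Fintype E] [DecidableEq Agt]
    (M : Kripke Var Agt W) (e1 e2 : E → Agt)
    (m : (t : ℕ) → Agt → IterW W E t → ZMod 2) (k : ℕ) :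
    Kripke (Var ⊕ Fin k) Agt (IterW W E k) where
  rel := IterRelC e1 e2 M.rel m k
  equiv := IterRelC_equiv e1 e2 M.rel M.equiv m k
  val p x :=
    match x with
    | Sum.inl v => M.val (IterW.base k p) v
    | Sum.inr t => decide (rrConc m k p t = 1)

/-- The stage-`k` abstract Kripke structure: worlds `Wa`, relations
`IterRelA`, and valuation over `Var ⊕ Fin k` assigning the `Mᵃ`-valuation at
each `v : Var` and the xor of the round-`(t+1)` messages at each `t : Fin k`. -/
def IterAbsK {Var Wa Agt : Type} [Fintype Agt]
    (Ma : Kripke Var Agt Wa) (ma : ℕ → Agt → Wa → ZMod 2) (k : ℕ) :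
    Kripke (Var ⊕ Fin k) Agt Wa where
  rel := IterRelA Ma.rel ma k
  equiv := IterRelA_equiv Ma.rel Ma.equiv ma k
  val u x :=
    match x with
    | Sum.inl v => Ma.val u v
    | Sum.inr t => decide ((∑ j, ma t j u) = 1)

/-- Key sums as a linear map. -/
def keyLin {Agt E : Type*} [Fintype E] [DecidableEq Agt]
    (e1 e2 : E → Agt) : (E → ZMod 2) →ₗ[ZMod 2] (Agt → ZMod 2) where
  toFun d j := keySum e1 e2 j d
  map_add' a b := by
    funext j
    simp [keySum, Finset.sum_add_distrib]
  map_smul' c a := by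
    funext j
    simp [keySum, Finset.mul_sum]

/-- Key assignments vanishing on the keys of `i`. -/
def zeroOn {Agt E : Type*} (e1 e2 : E → Agt) (i : Agt) : Submodule (ZMod 2) (E → ZMod 2) where
  carrier := {d | ∀ ε ∈ dcKeys e1 e2 i, d ε = 0}
  add_mem' := by
    intro a b ha hb ε hε
    simp [ha ε hε, hb ε hε]
  zero_mem' := by
    intro ε _
    rfl
  smul_mem' := by
    intro c a ha ε hε
    simp [ha ε hε]

theorem zmod2_add_self (a : ZMod 2) : a + a = 0 := CharTwo.add_self_eq_zero a

theorem sum_keySum {Agt E : Type*} [Fintype Agt] [Fintype E] [DecidableEq Agt]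
    (e1 e2 : E → Agt) (hloop : ∀ ε, e1 ε ≠ e2 ε) (d : E → ZMod 2) :
    ∑ j, keySum e1 e2 j d = 0 := by
  unfold keySum
  simp_rw [Finset.sum_filter]
  rw [Finset.sum_comm]
  apply Finset.sum_eq_zero
  intro ε _
  have : ∀ j, (if e1 ε = j ∨ e2 ε = j then d ε else 0)
      = (if e1 ε = j then d ε else 0) + (if e2 ε = j then d ε else 0) := by
    intro j
    have := hloop ε
    by_cases h1 : e1 ε = j
    · have h2 : e2 ε ≠ j := fun h => this (h1.trans h.symm)
      simp [h1, h2]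
    · simp [h1]
  simp_rw [this, Finset.sum_add_distrib]
  simp [zmod2_add_self]

theorem edge_mem {Agt E : Type*} [Fintype E] [DecidableEq Agt]
    (e1 e2 : E → Agt) (hloop : ∀ ε, e1 ε ≠ e2 ε) (i : Agt) (ε : E)
    (hε : ε ∉ dcKeys e1 e2 i) :
    (Pi.single (e1 ε) 1 + Pi.single (e2 ε) 1 : Agt → ZMod 2)
      ∈ (zeroOn e1 e2 i).map (keyLin e1 e2) := by
  classical
  refine ⟨Pi.single ε 1, ?_, ?_⟩
  · intro ε' h'
    have : ε' ≠ ε := by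
      rintro rfl
      exact hε h'
    simp [this]
  · funext j
    change keySum e1 e2 j _ = _
    unfold keySum
    have := hloop ε
    simp only [Finset.sum_pi_single', Finset.sum_filter, Pi.add_apply, Pi.single_apply]
    by_cases h1 : j = e1 ε
    · have h2 : j ≠ e2 ε := fun h => this (h1.symm.trans h)
      subst h1
      rw [Finset.sum_eq_single ε]
      · simp [h2]
      · intro b _ hb
        simp [hb]
      · simp
    · rw [Finset.sum_eq_single ε]
      · simp [h1, Ne.symm h1, eq_comm]
      · intro b _ hb
        simp [hb]
      · simp

theorem path_mem {Agt E : Type*} [Fintype E] [DecidableEq Agt]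
    (e1 e2 : E → Agt) (hloop : ∀ ε, e1 ε ≠ e2 ε) (i x y : Agt)
    (h : Relation.ReflTransGen
      (EdgeStep e1 e2 {ε | ε ∉ dcKeys e1 e2 i} {j | j ≠ i}) x y) :
    (Pi.single x 1 + Pi.single y 1 : Agt → ZMod 2)
      ∈ (zeroOn e1 e2 i).map (keyLin e1 e2) := by
  induction h with
  | refl =>
    convert Submodule.zero_mem _ using 1
    funext j
    exact zmod2_add_self _
  | @tail y z _ hs ih =>
    obtain ⟨_, _, ε, hε, he⟩ := hs
    have hm := edge_mem e1 e2 hloop i ε hε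
    have hyz : (Pi.single y 1 + Pi.single z 1 : Agt → ZMod 2)
        ∈ (zeroOn e1 e2 i).map (keyLin e1 e2) := by
      rcases he with ⟨h1, h2⟩ | ⟨h1, h2⟩
      · rwa [h1, h2] at hm
      · rw [h1, h2] at hm
        rwa [add_comm]
    convert Submodule.add_mem _ ih hyz using 1
    funext j
    simp only [Pi.add_apply]
    linear_combination -zmod2_add_self ((Pi.single y 1 : Agt → ZMod 2) j)

/-- Every even message difference that vanishes at `i` is realized by a change
of the keys not held by `i`. -/
theorem exists_keys {Agt E : Type*} [Fintype Agt] [Fintype E] [DecidableEq Agt]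
    (e1 e2 : E → Agt) (hloop : ∀ ε, e1 ε ≠ e2 ε) (i : Agt)
    (hconn : ConnectedOn e1 e2 {j | j ≠ i} {ε | ε ∉ dcKeys e1 e2 i})
    (d : Agt → ZMod 2) (hi : d i = 0) (hd : ∑ j, d j = 0) :
    d ∈ (zeroOn e1 e2 i).map (keyLin e1 e2) := by
  by_cases hx : ∃ x, x ≠ i
  · obtain ⟨x, hx⟩ := hx
    have hrep : d = ∑ y, d y • (Pi.single x 1 + Pi.single y 1 : Agt → ZMod 2) := by
      funext j
      simp only [Finset.sum_apply, Pi.smul_apply, Pi.add_apply, smul_eq_mul, mul_add,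
        Finset.sum_add_distrib, ← Finset.sum_mul, hd]
      simp [Pi.single_apply]
    rw [hrep]
    refine Submodule.sum_mem _ fun y _ => ?_
    by_cases hy : y = i
    · rw [hy, hi, zero_smul]
      exact Submodule.zero_mem _
    · exact Submodule.smul_mem _ _ (path_mem e1 e2 hloop i x y (hconn x hx y hy))
  · push Not at hx
    have : d = 0 := by
      funext j
      rw [hx j, hi]
      rfl
    rw [this]
    exact Submodule.zero_mem _

/-- iterated Dining Cryptographers abstraction: under the
connectivity assumption and conditions (i) and (ii) for each round `t` of the
`k` rounds, the relation `ℜ_k` is a bisimulation between the stage-`k`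
concrete and abstract structures with respect to `Var ⊕ Fin k` and `Agt`. -/
theorem iterated_dc_abstraction {Var W Wa E Agt : Type}
    [Fintype Agt] [Fintype E] [DecidableEq Agt]
    (M : Kripke Var Agt W) (Ma : Kripke Var Agt Wa)
    (e1 e2 : E → Agt) (hloop : ∀ ε, e1 ε ≠ e2 ε)
    (hconn : ∀ i, ConnectedOn e1 e2 {j | j ≠ i} {ε | ε ∉ dcKeys e1 e2 i})
    (R : W → Wa → Prop) (hbisim : Bisim M Ma R)
    (k : ℕ)
    (m : (t : ℕ) → Agt → IterW W E t → ZMod 2)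
    (ma : ℕ → Agt → Wa → ZMod 2)
    (hmsg : ∀ t < k, ∀ (p : IterW W E t) (u' : Wa),
      IterR R t p u' → ∀ j, m t j p = ma t j u')
    (hown : ∀ t < k, ∀ i (p q : IterW W E t),
      IterRelC e1 e2 M.rel m t i p q → m t i p = m t i q) :
    Bisim (IterConcK M e1 e2 m k) (IterAbsK Ma ma k) (IterR R k) := by
    induction k with
  | zero =>
    refine ⟨?_, hbisim.2.1, hbisim.2.2⟩
    rintro w u h (v | t)
    · exact hbisim.1 w u h v
    · exact t.elim0
  | succ k ih =>
    obtain ⟨ihA, ihF, ihB⟩ := ih (fun t ht => hmsg t (by omega)) (fun t ht => hown t (by omega))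
    have hmk := hmsg k (by omega)
    have hok := hown k (by omega)
    refine ⟨?_, ?_, ?_⟩
    · rintro ⟨w, κ⟩ u h (v | t)
      · exact ihA w u h (Sum.inl v)
      · have h' : IterR R k w u := h
        by_cases ht : (t : ℕ) = k
        · have : ∑ j, m k j w = ∑ j, ma k j u :=
            Finset.sum_congr rfl fun j _ => hmk w u h' j
          simp [IterConcK, IterAbsK, rrConc, ht, this]
        · have := ihA w u h' (Sum.inr ⟨t, by have := t.isLt; omega⟩)
          simpa [IterConcK, IterAbsK, rrConc, ht] using this
    · rintro i ⟨w₁, κ₁⟩ ⟨w₂, κ₂⟩ u₁ ⟨hr, _, hb⟩ h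
      obtain ⟨u₂, hu, hR⟩ := ihF i w₁ w₂ u₁ hr h
      refine ⟨u₂, ⟨hu, ?_⟩, hR⟩
      have hs := Finset.sum_congr (rfl : (Finset.univ : Finset Agt) = _) fun j _ => hb j
      simp only [Finset.sum_add_distrib, sum_keySum e1 e2 hloop, add_zero] at hs
      have a1 : ∑ j, m k j w₁ = ∑ j, ma k j u₁ :=
        Finset.sum_congr rfl fun j _ => hmk w₁ u₁ h j
      have a2 : ∑ j, m k j w₂ = ∑ j, ma k j u₂ :=
        Finset.sum_congr rfl fun j _ => hmk w₂ u₂ hR j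
      rw [← a1, ← a2, hs]
    · rintro i u₁ u₂ ⟨w₁, κ₁⟩ ⟨hu, hsum⟩ h
      obtain ⟨w₂, hw, hR⟩ := ihB i u₁ u₂ w₁ hu h
      have a1 : ∑ j, m k j w₁ = ∑ j, ma k j u₁ :=
        Finset.sum_congr rfl fun j _ => hmk w₁ u₁ h j
      have a2 : ∑ j, m k j w₂ = ∑ j, ma k j u₂ :=
        Finset.sum_congr rfl fun j _ => hmk w₂ u₂ hR j
      obtain ⟨δ, hδ0, hδ⟩ := exists_keys e1 e2 hloop i (hconn i)
        (fun j => m k j w₁ - m k j w₂) (sub_eq_zero.mpr (hok i w₁ w₂ hw))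
        (by rw [Finset.sum_sub_distrib, a1, a2, hsum, sub_self])
      refine ⟨(w₂, κ₁ + δ), ⟨hw, ?_, ?_⟩, hR⟩
      · intro ε hε
        have := hδ0 ε hε
        simp [this]
      · intro j
        have h1 : keySum e1 e2 j δ = m k j w₁ - m k j w₂ := congrFun hδ j
        have h2 : keySum e1 e2 j (κ₁ + δ) = keySum e1 e2 j κ₁ + keySum e1 e2 j δ :=
          congrFun ((keyLin e1 e2).map_add κ₁ δ) j
        change m k j w₁ + keySum e1 e2 j κ₁ = m k j w₂ + keySum e1 e2 j (κ₁ + δ)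
        rw [h2, h1]
        ring
end
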